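/- For bracketing functions E and F on {1,…,n}, one has E ≤ F pointwise (E(k) ≤ F(k) for all k) if and only if I_E ⊆ I_F; that is, the map E ↦ I_E is an order embedding of the Tamari lattice Tₙ into the permutation lattice Sₙ. -/

import Mathlib

/-- The inversion set of a permutation `σ` of `Fin n`: pairs `(a, b)` with `a > b`
such that `a` precedes `b` in the word `σ(1) σ(2) ⋯ σ(n)`, i.e. `σ⁻¹ a < σ⁻¹ b`. -/
def InvSet (n : ℕ) (σ : Equiv.Perm (Fin n)) : Set (Fin n × Fin n) :=
  {p | p.2 < p.1 ∧ σ.symm p.1 < σ.symm p.2}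

/-- `A` is the inversion set of some permutation of `Fin n`. -/
def IsInvSet (n : ℕ) (A : Set (Fin n × Fin n)) : Prop :=
  ∃ σ : Equiv.Perm (Fin n), A = InvSet n σ

/-- Condition (I1): `A` is transitive. -/
def CondI1 {n : ℕ} (A : Set (Fin n × Fin n)) : Prop :=
  ∀ a b c : Fin n, (a, b) ∈ A → (b, c) ∈ A → (a, c) ∈ A

/-- Condition (I2): if `b < c < a` and `(a, b) ∈ A`, then `(a, c) ∈ A` or `(c, b) ∈ A`. -/
def CondI2 {n : ℕ} (A : Set (Fin n × Fin n)) : Prop :=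
  ∀ a b c : Fin n, b < c → c < a → (a, b) ∈ A → (a, c) ∈ A ∨ (c, b) ∈ A

/-- Condition (I2)*: if `b < c < a` and `(a, b) ∈ A`, then `(c, b) ∈ A`. -/
def CondI2Star {n : ℕ} (A : Set (Fin n × Fin n)) : Prop :=
  ∀ a b c : Fin n, b < c → c < a → (a, b) ∈ A → (c, b) ∈ A

/-- A bracketing function on `Fin n`: (E1) `k ≤ E k`, and
(E2) if `k ≤ j ≤ E k` then `E j ≤ E k`. -/
def IsBracketing {n : ℕ} (E : Fin n → Fin n) : Prop :=
  (∀ k, k ≤ E k) ∧ ∀ k j, k ≤ j → j ≤ E k → E j ≤ E k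

/-- The set of pairs `I_E = {(a, k) : k < a ≤ E k}` associated to a bracketing function. -/
def IE {n : ℕ} (E : Fin n → Fin n) : Set (Fin n × Fin n) :=
  {p | p.2 < p.1 ∧ p.1 ≤ E p.2}

/-- The transitive closure of a set of pairs. -/
def TrCl {n : ℕ} (A : Set (Fin n × Fin n)) : Set (Fin n × Fin n) :=
  {p | Relation.TransGen (fun a b => (a, b) ∈ A) p.1 p.2}
/-- For bracketing functions `E, F`, `E ≤ F` pointwise iff `I_E ⊆ I_F`; i.e. the map
`E ↦ I_E` is an order embedding of the Tamari lattice `Tₙ` into `Sₙ`. -/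
theorem stmt_12 (n : ℕ) (E F : Fin n → Fin n) (hE : IsBracketing E) (hF : IsBracketing F) :
    (∀ k, E k ≤ F k) ↔ IE E ⊆ IE F := by
  refine ⟨fun h p hp => ⟨hp.1, hp.2.trans (h p.2)⟩, fun h k => ?_⟩
  rcases (hE.1 k).eq_or_lt with hk | hk
  · exact hk.symm.le.trans (hF.1 k)
  · exact (@h (E k, k) ⟨hk, le_rfl⟩).2
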